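/- Let R be a commutative Noetherian local ring of Krull dimension d and let M be a nonzero finitely generated R-module such that Hom_R(M,M) has finite injective dimension, Ext_R^i(M,M) = 0 for all 1 ≤ i ≤ d−1, and Ext_R^j(M,R) = 0 for all 1 ≤ j ≤ d. Then M is free and R is Gorenstein. -/

import Mathlib

open CategoryTheory

noncomputable section

/-- The `i`-th Ext module of two `R`-modules. -/
def extMod (R : Type) [CommRing R] (i : ℕ) (M N : Type) [AddCommGroup M] [Module R M]
    [AddCommGroup N] [Module R N] : ModuleCat R :=
  ((Ext R (ModuleCat R) i).obj (Opposite.op (ModuleCat.of R M))).obj (ModuleCat.of R N)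

/-- The `i`-th Tor module of two `R`-modules. -/
def torMod (R : Type) [CommRing R] (i : ℕ) (M N : Type) [AddCommGroup M] [Module R M]
    [AddCommGroup N] [Module R N] : ModuleCat R :=
  ((Tor (ModuleCat R) i).obj (ModuleCat.of R M)).obj (ModuleCat.of R N)

/-- The depth of a module over a local ring: the infimum of the set of
indices `i` with `Ext^i(R/𝔪, N) ≠ 0`. -/
def moduleDepth (R : Type) [CommRing R] [IsLocalRing R] (N : Type) [AddCommGroup N]
    [Module R N] : ℕ :=
  sInf {i : ℕ | ¬ Subsingleton (extMod R i (R ⧸ IsLocalRing.maximalIdeal R) N)}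

/-- An `R`-module `N` has finite injective dimension iff there is an `n` such that
`Ext^i(M, N) = 0` for all modules `M` and all `i > n`. -/
def HasFiniteInjDim (R : Type) [CommRing R] (N : Type) [AddCommGroup N] [Module R N] : Prop :=
  ∃ n : ℕ, ∀ (M : Type) [AddCommGroup M] [Module R M], ∀ i : ℕ, n < i →
    Subsingleton (extMod R i M N)

/-- An `R`-module `M` has finite projective dimension iff there is an `n` such that
`Ext^i(M, N) = 0` for all modules `N` and all `i > n`. -/
def HasFiniteProjDim (R : Type) [CommRing R] (M : Type) [AddCommGroup M] [Module R M] : Prop :=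
  ∃ n : ℕ, ∀ (N : Type) [AddCommGroup N] [Module R N], ∀ i : ℕ, n < i →
    Subsingleton (extMod R i M N)

/-- The `𝔪`-torsion submodule `Γ_𝔪(M)` of a module over a local ring. -/
def mTorsion (R : Type) [CommRing R] [IsLocalRing R] (M : Type) [AddCommGroup M]
    [Module R M] : Submodule R M :=
  ⨆ n : ℕ, Submodule.torsionBySet R M ((IsLocalRing.maximalIdeal R ^ n : Ideal R) : Set R)

/-- A semidualizing module: the natural map `R → Hom(C,C)` is bijective and
`Ext^i(C,C) = 0` for all `i ≥ 1`. -/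
structure IsSemidualizing (R : Type) [CommRing R] (C : Type) [AddCommGroup C]
    [Module R C] : Prop where
  bijective : Function.Bijective (LinearMap.lsmul R C)
  ext_vanish : ∀ i : ℕ, 1 ≤ i → Subsingleton (extMod R i C C)

/-- Membership in the Auslander class `A_C(R)`: the natural map `M → Hom(C, C ⊗ M)` is
bijective, `Tor_i(C, M) = 0` and `Ext^i(C, C ⊗ M) = 0` for all `i ≥ 1`. -/
structure MemAuslanderClass (R : Type) [CommRing R] (C : Type) [AddCommGroup C] [Module R C]
    (M : Type) [AddCommGroup M] [Module R M] : Prop where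
  bijective : Function.Bijective ((TensorProduct.mk R C M).flip)
  tor_vanish : ∀ i : ℕ, 1 ≤ i → Subsingleton (torMod R i C M)
  ext_vanish : ∀ i : ℕ, 1 ≤ i → Subsingleton (extMod R i C (TensorProduct R C M))

/-- A module `N` is Tor-rigid if for every finitely generated module `M` and every `i ≥ 1`,
`Tor_i(M, N) = 0` implies `Tor_{i+1}(M, N) = 0`. -/
def IsTorRigid (R : Type) [CommRing R] (N : Type) [AddCommGroup N] [Module R N] : Prop :=
  ∀ (M : Type) [AddCommGroup M] [Module R M], Module.Finite R M →
    ∀ i : ℕ, 1 ≤ i → Subsingleton (torMod R i M N) → Subsingleton (torMod R (i + 1) M N)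

/-- The natural map `C ⊗ Hom(M,N) → Hom(M, C ⊗ N)`, sending `c ⊗ φ` to `m ↦ c ⊗ φ m`. -/
def homTensorMap (R : Type) [CommRing R] (C M N : Type) [AddCommGroup C] [Module R C]
    [AddCommGroup M] [Module R M] [AddCommGroup N] [Module R N] :
    TensorProduct R C (M →ₗ[R] N) →ₗ[R] (M →ₗ[R] TensorProduct R C N) :=
  TensorProduct.lift
    ((LinearMap.llcomp R M N (TensorProduct R C N)).comp (TensorProduct.mk R C N))

open CategoryTheory.Abelian in
theorem subsingleton_extMod_iff {R : Type} [CommRing R] (n : ℕ) (M N : Type)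
    [AddCommGroup M] [Module R M] [AddCommGroup N] [Module R N] :
    Subsingleton (extMod R (n + 1) M N) ↔
      Subsingleton (Abelian.Ext (ModuleCat.of R M) (ModuleCat.of R N) (n + 1)) := by
  let P := projectiveResolution (ModuleCat.of R M)
  have h1 : Subsingleton (extMod R (n + 1) M N) ↔
      ((P.complex.linearYonedaObj R (ModuleCat.of R N)).sc' n (n + 1) (n + 2)).Exact := by
    rw [← HomologicalComplex.exactAt_iff' _ n (n + 1) (n + 2) (by simp) (by simp),
      HomologicalComplex.exactAt_iff_isZero_homology, ← ModuleCat.isZero_iff_subsingleton]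
    exact (P.isoExt (n + 1) (ModuleCat.of R N)).isZero_iff
  rw [h1, ShortComplex.moduleCat_exact_iff]
  constructor
  · intro h
    refine subsingleton_of_forall_eq 0 fun α => ?_
    obtain ⟨f, hf, rfl⟩ := P.extMk_surjective α (n + 2) rfl
    rw [P.extMk_eq_zero_iff _ _ _ _ n rfl]
    exact h f hf
  · intro h f hf
    exact (P.extMk_eq_zero_iff f (n + 2) rfl hf n rfl).1 (Subsingleton.elim _ _)

/-- Vanishing of the `n`-th `Ext` group of two modules. -/
abbrev ExtVanishes (R : Type) [CommRing R] (n : ℕ) (M N : Type) [AddCommGroup M] [Module R M]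
    [AddCommGroup N] [Module R N] : Prop :=
  Subsingleton (Abelian.Ext (ModuleCat.of R M) (ModuleCat.of R N) n)

section ExtVanishes

open CategoryTheory.Abelian

variable {R : Type} [CommRing R] {A B C X Y : Type} [AddCommGroup A] [Module R A]
  [AddCommGroup B] [Module R B] [AddCommGroup C] [Module R C] [AddCommGroup X] [Module R X]
  [AddCommGroup Y] [Module R Y]

theorem extVanishes_of_retract_left {n : ℕ} (i : A →ₗ[R] B) (p : B →ₗ[R] A)
    (h : p ∘ₗ i = LinearMap.id) (H : ExtVanishes R n B Y) : ExtVanishes R n A Y := by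
  refine subsingleton_of_forall_eq 0 fun α => ?_
  have h1 : (Ext.mk₀ (ModuleCat.ofHom i)).comp
      ((Ext.mk₀ (ModuleCat.ofHom p)).comp α (zero_add n)) (zero_add n) = α := by
    rw [Ext.mk₀_comp_mk₀_assoc, ← ModuleCat.ofHom_comp, h, ModuleCat.ofHom_id, Ext.mk₀_id_comp]
  rw [← h1, Subsingleton.elim ((Ext.mk₀ (ModuleCat.ofHom p)).comp α (zero_add n)) 0,
    Ext.comp_zero]

theorem extVanishes_of_retract_right {n : ℕ} (i : A →ₗ[R] B) (p : B →ₗ[R] A)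
    (h : p ∘ₗ i = LinearMap.id) (H : ExtVanishes R n X B) : ExtVanishes R n X A := by
  refine subsingleton_of_forall_eq 0 fun α => ?_
  have h1 : (α.comp (Ext.mk₀ (ModuleCat.ofHom i)) (add_zero n)).comp
      (Ext.mk₀ (ModuleCat.ofHom p)) (add_zero n) = α := by
    rw [Ext.comp_assoc_of_third_deg_zero, Ext.mk₀_comp_mk₀, ← ModuleCat.ofHom_comp, h,
      ModuleCat.ofHom_id, Ext.comp_mk₀_id]
  rw [← h1, Subsingleton.elim (α.comp (Ext.mk₀ (ModuleCat.ofHom i)) (add_zero n)) 0,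
    Ext.zero_comp]

theorem extVanishes_of_projective [Module.Projective R A] (n : ℕ) :
    ExtVanishes R (n + 1) A Y :=
  have : Projective (ModuleCat.of R A) := (IsProjective.iff_projective A).1 inferInstance
  subsingleton_of_forall_eq 0 fun α => Ext.eq_zero_of_projective α

theorem shortExact_of_exact {f : A →ₗ[R] B} {g : B →ₗ[R] C} (hf : Function.Injective f)
    (hg : Function.Surjective g) (hfg : Function.Exact f g) :
    (ModuleCat.shortComplexOfCompEqZero f g hfg.linearMap_comp_eq_zero).ShortExact :=
  ModuleCat.shortComplex_shortExact _ hfg hf hg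

section

variable {f : A →ₗ[R] B} {g : B →ₗ[R] C} (hf : Function.Injective f)
  (hg : Function.Surjective g) (hfg : Function.Exact f g)

include hf hg hfg

theorem extVanishes_left_mid {n : ℕ} (hA : ExtVanishes R n A Y) (hC : ExtVanishes R n C Y) :
    ExtVanishes R n B Y := by
  refine subsingleton_of_forall_eq 0 fun α => ?_
  obtain ⟨β, rfl⟩ := Ext.contravariant_sequence_exact₂ (shortExact_of_exact hf hg hfg) _ α
    (hA.elim _ _)
  rw [hC.elim β 0, Ext.comp_zero]

theorem extVanishes_left_fst {n : ℕ} (hB : ExtVanishes R n B Y)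
    (hC : ExtVanishes R (n + 1) C Y) : ExtVanishes R n A Y := by
  refine subsingleton_of_forall_eq 0 fun α => ?_
  obtain ⟨β, rfl⟩ := Ext.contravariant_sequence_exact₁ (shortExact_of_exact hf hg hfg) _ α
    (add_comm 1 n) (hC.elim _ _)
  rw [hB.elim β 0, Ext.comp_zero]

theorem extVanishes_left_lst {n : ℕ} (hA : ExtVanishes R n A Y)
    (hB : ExtVanishes R (n + 1) B Y) : ExtVanishes R (n + 1) C Y := by
  refine subsingleton_of_forall_eq 0 fun α => ?_
  obtain ⟨β, rfl⟩ := Ext.contravariant_sequence_exact₃ (shortExact_of_exact hf hg hfg) _ α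
    (hB.elim _ _) (add_comm 1 n)
  rw [hA.elim β 0, Ext.comp_zero]

theorem extVanishes_right_lst {n : ℕ} (hB : ExtVanishes R n X B)
    (hA : ExtVanishes R (n + 1) X A) : ExtVanishes R n X C := by
  refine subsingleton_of_forall_eq 0 fun α => ?_
  obtain ⟨β, rfl⟩ := Ext.covariant_sequence_exact₃ _ (shortExact_of_exact hf hg hfg) α
    rfl (hA.elim _ _)
  rw [hB.elim β 0, Ext.zero_comp]

/-- If `Ext¹(C, Y) = 0`, maps into `Y` extend along an injection with cokernel `C`. -/
theorem exists_extension_of_extVanishes (hC : ExtVanishes R 1 C Y) (u : A →ₗ[R] Y) :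
    ∃ v : B →ₗ[R] Y, v ∘ₗ f = u := by
  obtain ⟨β, hβ⟩ := Ext.contravariant_sequence_exact₁ (shortExact_of_exact hf hg hfg)
    (ModuleCat.of R Y) (Ext.mk₀ (ModuleCat.ofHom u)) (add_comm 1 0) (hC.elim _ _)
  obtain ⟨v, rfl⟩ := (Ext.mk₀_bijective _ _).2 β
  refine ⟨v.hom, ?_⟩
  have := (Ext.mk₀_bijective _ _).1 ((Ext.mk₀_comp_mk₀ _ _).symm.trans hβ)
  exact ModuleCat.hom_ext_iff.1 this

/-- If `Ext¹(X, A) = 0`, maps from `X` lift along a surjection with kernel `A`. -/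
theorem exists_lift_of_extVanishes (hA : ExtVanishes R 1 X A) (u : X →ₗ[R] C) :
    ∃ v : X →ₗ[R] B, g ∘ₗ v = u := by
  obtain ⟨β, hβ⟩ := Ext.covariant_sequence_exact₃ (ModuleCat.of R X)
    (shortExact_of_exact hf hg hfg) (Ext.mk₀ (ModuleCat.ofHom u)) rfl (hA.elim _ _)
  obtain ⟨v, rfl⟩ := (Ext.mk₀_bijective _ _).2 β
  refine ⟨v.hom, ?_⟩
  have := (Ext.mk₀_bijective _ _).1 ((Ext.mk₀_comp_mk₀ _ _).symm.trans hβ)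
  exact ModuleCat.hom_ext_iff.1 this

/-- `Ext¹(C, Y) = 0` as soon as all maps to `Y` extend along the first syzygy of `C`. -/
theorem extVanishes_one_of_extension [Module.Projective R B]
    (H : ∀ u : A →ₗ[R] Y, ∃ v : B →ₗ[R] Y, v ∘ₗ f = u) : ExtVanishes R 1 C Y := by
  refine subsingleton_of_forall_eq 0 fun α => ?_
  have := extVanishes_of_projective (R := R) (A := B) (Y := Y) 0
  have hS := shortExact_of_exact hf hg hfg
  obtain ⟨β, rfl⟩ := Ext.contravariant_sequence_exact₃ hS _ α
    (this.elim _ _) (add_comm 1 0)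
  obtain ⟨u, rfl⟩ := (Ext.mk₀_bijective _ _).2 β
  obtain ⟨v, hv⟩ := H u.hom
  have : u = ModuleCat.ofHom f ≫ ModuleCat.ofHom v := by
    ext1; exact hv.symm
  rw [this, ← Ext.mk₀_comp_mk₀]
  exact hS.extClass_comp_assoc _

theorem extVanishes_succ_iff_of_projective [Module.Projective R B] (n : ℕ) :
    ExtVanishes R (n + 2) C Y ↔ ExtVanishes R (n + 1) A Y :=
  ⟨fun h => extVanishes_left_fst hf hg hfg (extVanishes_of_projective n) h,
    fun h => extVanishes_left_lst hf hg hfg h (extVanishes_of_projective (n + 1))⟩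

end

theorem extVanishes_of_smul_regular_left [IsNoetherianRing R] [IsLocalRing R] [Module.Finite R A]
    [Module.Finite R Y] {n : ℕ} {x : R} (hx : x ∈ IsLocalRing.maximalIdeal R) {f : A →ₗ[R] A}
    (hfx : ∀ a, f a = x • a) {g : A →ₗ[R] C} (hf : Function.Injective f)
    (hg : Function.Surjective g) (hfg : Function.Exact f g) (hC : ExtVanishes R (n + 1) C Y) :
    ExtVanishes R n A Y := by
  have hS := shortExact_of_exact hf hg hfg
  have h1 : ∀ α : Ext (ModuleCat.of R A) (ModuleCat.of R Y) n, ∃ β, x • β = α := by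
    intro α
    obtain ⟨β, hβ⟩ := Ext.contravariant_sequence_exact₁ hS _ α
      (add_comm 1 n) (hC.elim _ _)
    refine ⟨β, ?_⟩
    rw [← hβ]
    have : ModuleCat.ofHom f = x • 𝟙 (ModuleCat.of R A) := by
      ext a; simpa using hfx a
    change _ = (Ext.mk₀ (ModuleCat.ofHom f)).comp β (zero_add n)
    rw [this, Ext.mk₀_smul, Ext.smul_comp, Ext.mk₀_id_comp]
  have h2 : (⊤ : Submodule R (Ext (ModuleCat.of R A) (ModuleCat.of R Y) n)) = ⊥ := by
    refine Submodule.eq_bot_of_le_smul_of_le_jacobson_bot (IsLocalRing.maximalIdeal R) _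
      Module.Finite.fg_top ?_ (IsLocalRing.maximalIdeal_le_jacobson ⊥)
    intro α _
    obtain ⟨β, rfl⟩ := h1 α
    exact Submodule.smul_mem_smul hx trivial
  exact (Submodule.subsingleton_iff R).1 (subsingleton_of_bot_eq_top h2.symm)

theorem extVanishes_of_subsingleton_left [Subsingleton A] (n : ℕ) : ExtVanishes R n A Y := by
  refine subsingleton_of_forall_eq 0 fun α => ?_
  have : 𝟙 (ModuleCat.of R A) = 0 := by ext a; exact Subsingleton.elim (α := A) _ _
  rw [← Ext.mk₀_id_comp α, this, Ext.mk₀_zero, Ext.zero_comp]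

end ExtVanishes

/-- A linear map factors through any surjection whose kernel it annihilates. -/
theorem exists_comp_eq_of_ker_le {R A B C : Type} [CommRing R] [AddCommGroup A] [Module R A]
    [AddCommGroup B] [Module R B] [AddCommGroup C] [Module R C] {g : A →ₗ[R] B}
    (hg : Function.Surjective g) {u : A →ₗ[R] C} (h : LinearMap.ker g ≤ LinearMap.ker u) :
    ∃ v : B →ₗ[R] C, v ∘ₗ g = u := by
  refine ⟨((LinearMap.ker g).liftQ u h) ∘ₗ
    (g.quotKerEquivOfSurjective hg).symm.toLinearMap, ?_⟩
  ext b
  have : (g.quotKerEquivOfSurjective hg).symm (g b) = Submodule.Quotient.mk b := by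
    rw [LinearEquiv.symm_apply_eq]; rfl
  simp [this]

section InjectiveBase

open IsLocalRing

variable {R : Type} [CommRing R] [IsNoetherianRing R] [IsLocalRing R]

omit [IsNoetherianRing R] in
theorem exists_surjective_fin_of_length (E : Type) [AddCommGroup E] [Module R E]
    [Module.Finite R E] :
    ∃ (q : ℕ) (g : (Fin q → R) →ₗ[R] E), Function.Surjective g ∧
      (q : ℕ∞) ≤ Module.length R (E ⧸ (maximalIdeal R • ⊤ : Submodule R E)) := by
  let : Field (R ⧸ maximalIdeal R) := Ideal.Quotient.field _
  let Q := E ⧸ (maximalIdeal R • ⊤ : Submodule R E)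
  have : Module.Finite (R ⧸ maximalIdeal R) Q :=
    Module.Finite.of_restrictScalars_finite R _ _
  let b := Module.finBasis (R ⧸ maximalIdeal R) Q
  choose v hv using fun i => Submodule.mkQ_surjective (maximalIdeal R • ⊤ : Submodule R E) (b i)
  refine ⟨_, Fintype.linearCombination R v, ?_, ?_⟩
  · rw [← LinearMap.range_eq_top, Fintype.range_linearCombination]
    have h1 : (⊤ : Submodule R E) ≤ Submodule.span R (Set.range v) := by
      refine Submodule.le_of_le_smul_of_le_jacobson_bot (I := maximalIdeal R)
        Module.Finite.fg_top (maximalIdeal_le_jacobson ⊥) ?_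
      intro e _
      have h2 : Submodule.map (maximalIdeal R • ⊤ : Submodule R E).mkQ
          (Submodule.span R (Set.range v)) = ⊤ := by
        rw [Submodule.map_span, ← Set.range_comp]
        have h3 : ((maximalIdeal R • ⊤ : Submodule R E).mkQ ∘ v) = b := funext hv
        rw [h3]
        have := congrArg (Submodule.restrictScalars R) b.span_eq
        rw [Submodule.restrictScalars_span R _ Ideal.Quotient.mk_surjective] at this
        exact this
      have h4 : (maximalIdeal R • ⊤ : Submodule R E).mkQ e ∈ Submodule.map
        (maximalIdeal R • ⊤ : Submodule R E).mkQ (Submodule.span R (Set.range v)) := by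
        rw [h2]; trivial
      obtain ⟨s, hs, hse⟩ := h4
      have h5 : e - s ∈ (maximalIdeal R • ⊤ : Submodule R E) := by
        rw [← Submodule.Quotient.mk_eq_zero, Submodule.Quotient.mk_sub, sub_eq_zero]
        exact hse.symm
      rw [← add_sub_cancel s e]
      exact add_mem (Submodule.mem_sup_left hs) (Submodule.mem_sup_right h5)
    exact top_le_iff.1 h1
  · rw [Module.length_eq_of_surjective (S := R) (R := R ⧸ maximalIdeal R)
      Ideal.Quotient.mk_surjective, Module.length_eq_finrank]

variable {N : Type} [AddCommGroup N] [Module R N] [Module.Finite R N]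

/-- The support of a finitely generated injective module over a Noetherian local ring is the
closed point: a nonzero element annihilated by a prime forces that prime to be maximal. -/
theorem eq_maximalIdeal_of_injective_of_smul_eq_zero [Module.Injective R N] (p : Ideal R)
    [p.IsPrime] {n : N} (hn : n ≠ 0) (hp : ∀ a ∈ p, a • n = 0) : p = maximalIdeal R := by
  by_contra hne
  have hle : p ≤ maximalIdeal R := le_maximalIdeal (Ideal.IsPrime.ne_top inferInstance)
  obtain ⟨y, hy, hyp⟩ := SetLike.exists_of_lt (lt_of_le_of_ne hle hne)
  let T : Submodule R N := Submodule.torsionBySet R N p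
  have hT : T = ⊥ := by
    refine Submodule.eq_bot_of_le_smul_of_le_jacobson_bot (maximalIdeal R) T
      (IsNoetherian.noetherian T) ?_ (maximalIdeal_le_jacobson ⊥)
    intro t ht
    let u : (R ⧸ p) →ₗ[R] N := p.liftQ (LinearMap.toSpanSingleton R N t) (by
      intro a ha
      simpa using (Submodule.mem_torsionBySet_iff _ _).1 ht ⟨a, ha⟩)
    obtain ⟨v, hv⟩ := Module.Injective.out (LinearMap.lsmul R (R ⧸ p) y) (by
      rw [injective_iff_map_eq_zero]
      intro a ha
      obtain ⟨a, rfl⟩ := Ideal.Quotient.mk_surjective a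
      have : Ideal.Quotient.mk p (y * a) = 0 := ha
      rw [Ideal.Quotient.eq_zero_iff_mem] at this ⊢
      exact ((‹p.IsPrime›.mem_or_mem this).resolve_left hyp)) u
    have h1 := hv 1
    have h2 : u 1 = t := by
      exact (Submodule.liftQ_apply _ _ (1 : R)).trans (by simp)
    rw [h2, LinearMap.lsmul_apply, map_smul] at h1
    rw [← h1]
    refine Submodule.smul_mem_smul hy ((Submodule.mem_torsionBySet_iff _ _).2 fun a => ?_)
    rw [← map_smul]
    have : (a : R) • (1 : R ⧸ p) = 0 := by
      change Ideal.Quotient.mk p ((a : R) * 1) = 0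
      rw [Ideal.Quotient.eq_zero_iff_mem, mul_one]
      exact a.2
    change v ((a : R) • 1) = 0
    rw [this, map_zero]
  apply hn
  rw [← Submodule.mem_bot R, ← hT]
  exact (Submodule.mem_torsionBySet_iff _ _).2 fun a => hp a a.2

theorem exists_socle_ne_zero_of_injective [Module.Injective R N] [Nontrivial N] :
    ∃ s : N, s ≠ 0 ∧ ∀ a ∈ maximalIdeal R, a • s = 0 := by
  obtain ⟨q, hq⟩ := associatedPrimes.nonempty R N
  obtain ⟨hqp, s, hs⟩ := isAssociatedPrime_iff.1 hq
  have hs0 : s ≠ 0 := by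
    rintro rfl
    apply hqp.ne_top
    rw [hs, Ideal.eq_top_iff_one, Submodule.mem_colon_singleton]
    simp
  have hq0 : ∀ a ∈ q, a • s = 0 := by
    intro a ha
    rw [hs, Submodule.mem_colon_singleton] at ha
    simpa using ha
  refine ⟨s, hs0, ?_⟩
  rwa [← eq_maximalIdeal_of_injective_of_smul_eq_zero q hs0 hq0]

theorem isArtinianRing_of_injective [Module.Injective R N] [Nontrivial N] : IsArtinianRing R := by
  rw [isArtinianRing_iff_krullDimLE_zero, Ring.krullDimLE_zero_iff]
  obtain ⟨s, hs0, hs⟩ := exists_socle_ne_zero_of_injective (R := R) (N := N)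
  intro p hp
  rw [eq_maximalIdeal_of_injective_of_smul_eq_zero p hs0
    fun a ha => hs a (le_maximalIdeal hp.ne_top ha)]
  infer_instance

omit [IsNoetherianRing R] [Module.Finite R N] in
theorem eq_zero_of_injective_of_annihilates [Module.Injective R N] {s : N} (hs0 : s ≠ 0)
    (hs : ∀ a ∈ maximalIdeal R, a • s = 0) {a : R} (ha : ∀ n : N, a • n = 0) : a = 0 := by
  by_contra ha0
  let t := LinearMap.toSpanSingleton R R a
  let f : (R ⧸ LinearMap.ker t) →ₗ[R] R := (LinearMap.ker t).liftQ t le_rfl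
  have hf : Function.Injective f := by
    rw [← LinearMap.ker_eq_bot]
    exact Submodule.ker_liftQ_eq_bot _ _ _ le_rfl
  let u : (R ⧸ LinearMap.ker t) →ₗ[R] N :=
    (LinearMap.ker t).liftQ (LinearMap.toSpanSingleton R N s) (by
      intro b hb
      have hb' : b * a = 0 := by simpa [t] using hb
      have : b ∈ maximalIdeal R := by
        rw [mem_maximalIdeal, mem_nonunits_iff]
        intro hu
        exact ha0 (hu.mul_right_eq_zero.1 hb')
      simpa using hs b this)
  obtain ⟨v, hv⟩ := Module.Injective.out f hf u
  have h1 := hv (Submodule.Quotient.mk 1)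
  have h2 : f (Submodule.Quotient.mk 1) = a • 1 :=
    (Submodule.liftQ_apply _ _ _).trans (by simp [t])
  have h3 : u (Submodule.Quotient.mk 1) = s :=
    (Submodule.liftQ_apply _ _ _).trans (by simp)
  rw [h2, h3, map_smul, ha] at h1
  exact hs0 h1.symm

end InjectiveBase

section InjectiveLength

open IsLocalRing

variable {R : Type} [CommRing R] [IsNoetherianRing R] [IsLocalRing R]
  {N : Type} [AddCommGroup N] [Module R N]

omit [IsNoetherianRing R] [IsLocalRing R] in
theorem map_eq_sum_single {ι A C : Type} [Fintype ι] [DecidableEq ι] [AddCommGroup A] [Module R A]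
    [AddCommGroup C] [Module R C] (v : (ι → A) →ₗ[R] C) (x : ι → A) :
    v x = ∑ i, v (LinearMap.single R (fun _ => A) i (x i)) := by
  conv_lhs => rw [← Finset.univ_sum_single x, map_sum]
  rfl

theorem length_hom_eq_of_injective [IsArtinianRing R] [Module.Injective R N] (L : Type)
    [AddCommGroup L] [Module R L] [Module.Finite R L] :
    Module.length R (L →ₗ[R] N) =
      Module.length R (R ⧸ maximalIdeal R →ₗ[R] N) * Module.length R L := by
  induction ‹Module.Finite R L› using
    IsNoetherianRing.induction_on_isQuotientEquivQuotientPrime R with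
  | subsingleton L => simp [Module.length_eq_zero]
  | quotient L p e =>
    have hp : p.1 = maximalIdeal R := IsLocalRing.eq_maximalIdeal (Ideal.isMaximal_of_isPrime p.1)
    have : IsSimpleModule R (R ⧸ p.1) := isSimpleModule_iff_isCoatom.2
      (Ideal.isMaximal_def.1 (Ideal.isMaximal_of_isPrime p.1))
    rw [e.length_eq, Module.length_eq_one R (R ⧸ p.1), mul_one, ← hp]
    exact (LinearEquiv.congrLeft N R e).length_eq
  | exact A B C f g hf hg hfg hA hC =>
    rw [Module.length_eq_add_of_exact f g hf hg hfg, mul_add, ← hA, ← hC, add_comm]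
    refine Module.length_eq_add_of_exact (LinearMap.lcomp R N g) (LinearMap.lcomp R N f) ?_ ?_ ?_
    · intro u v h
      ext c
      obtain ⟨b, rfl⟩ := hg c
      exact LinearMap.congr_fun h b
    · intro u
      obtain ⟨v, hv⟩ := Module.Injective.out f hf u
      exact ⟨v, LinearMap.ext hv⟩
    · intro u
      constructor
      · intro h
        have hk : LinearMap.ker g ≤ LinearMap.ker u := by
          intro b hb
          obtain ⟨a, rfl⟩ := (hfg b).1 hb
          exact LinearMap.congr_fun h a
        exact exists_comp_eq_of_ker_le hg hk
      · rintro ⟨v, rfl⟩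
        ext a
        simp [hfg.apply_apply_eq_zero]

variable [Module.Finite R N]

omit [Module.Finite R N] in
/-- Endomorphisms of an injective module killing the socle lie in `𝔪 • End N`. -/
theorem mem_smul_top_of_socle_le_ker [Module.Injective R N] (φ : N →ₗ[R] N)
    (h : ∀ n : N, (∀ a ∈ maximalIdeal R, a • n = 0) → φ n = 0) :
    φ ∈ (maximalIdeal R • ⊤ : Submodule R (N →ₗ[R] N)) := by
  obtain ⟨r, a, ha⟩ := Submodule.fg_iff_exists_fin_generating_family.1
    (IsNoetherian.noetherian (maximalIdeal R))
  let α : N →ₗ[R] (Fin r → N) := LinearMap.pi fun i => LinearMap.lsmul R N (a i)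
  have hk : LinearMap.ker α ≤ LinearMap.ker φ := by
    intro n hn
    have hn' : ∀ i, a i • n = 0 := fun i => congrFun hn i
    refine h n fun b hb => ?_
    rw [← ha] at hb
    induction hb using Submodule.span_induction with
    | mem x hx => obtain ⟨i, rfl⟩ := hx; exact hn' i
    | zero => simp
    | add x y _ _ hx hy => rw [add_smul, hx, hy, add_zero]
    | smul c x _ hx => rw [smul_assoc, hx, smul_zero]
  let f : (N ⧸ LinearMap.ker α) →ₗ[R] (Fin r → N) := (LinearMap.ker α).liftQ α le_rfl
  have hf : Function.Injective f := by
    rw [← LinearMap.ker_eq_bot]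
    exact Submodule.ker_liftQ_eq_bot _ _ _ le_rfl
  obtain ⟨v, hv⟩ := Module.Injective.out f hf ((LinearMap.ker α).liftQ φ hk)
  have h1 : φ = ∑ i, a i • (v ∘ₗ LinearMap.single R (fun _ => N) i) := by
    ext n
    have h2 : v (α n) = φ n := hv (Submodule.Quotient.mk n)
    rw [← h2, map_eq_sum_single]
    simp [α, ← map_smul, ← Pi.single_smul]
  rw [h1]
  refine Submodule.sum_mem _ fun i _ => Submodule.smul_mem_smul ?_ trivial
  rw [← ha]
  exact Submodule.subset_span ⟨i, rfl⟩

omit [IsNoetherianRing R] [Module.Finite R N] in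
theorem length_socle_eq :
    Module.length R (Submodule.torsionBySet R N (maximalIdeal R)) =
      Module.length R (R ⧸ maximalIdeal R →ₗ[R] N) := by
  let e : (R ⧸ maximalIdeal R →ₗ[R] N) →ₗ[R] Submodule.torsionBySet R N (maximalIdeal R) :=
    { toFun := fun u => ⟨u 1, (Submodule.mem_torsionBySet_iff _ _).2 fun a => by
        rw [← map_smul]
        have : (a : R) • (1 : R ⧸ maximalIdeal R) = 0 := by
          change Ideal.Quotient.mk _ ((a : R) * 1) = 0
          rw [Ideal.Quotient.eq_zero_iff_mem, mul_one]
          exact a.2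
        change u ((a : R) • 1) = 0
        rw [this, map_zero]⟩
      map_add' := fun _ _ => rfl
      map_smul' := fun _ _ => rfl }
  refine (LinearEquiv.ofBijective e ⟨?_, ?_⟩).length_eq.symm
  · intro u v h
    have h1 : u 1 = v 1 := congrArg Subtype.val h
    ext
    exact h1
  · rintro ⟨t, ht⟩
    refine ⟨(maximalIdeal R).liftQ (LinearMap.toSpanSingleton R N t) ?_, ?_⟩
    · intro a ha
      simpa using (Submodule.mem_torsionBySet_iff _ _).1 ht ⟨a, ha⟩
    · apply Subtype.ext
      exact (Submodule.liftQ_apply _ _ (1 : R)).trans (by simp)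

/-- The endomorphism module of a finitely generated injective module is free. -/
theorem exists_equiv_fin_end_of_injective [IsArtinianRing R] [Module.Injective R N] :
    ∃ q : ℕ, Nonempty ((Fin q → R) ≃ₗ[R] (N →ₗ[R] N)) := by
  obtain ⟨q, g, hg, hq⟩ := exists_surjective_fin_of_length (R := R) (N →ₗ[R] N)
  set n := Module.length R (R ⧸ maximalIdeal R →ₗ[R] N) with hn
  have h1 : Module.length R ((N →ₗ[R] N) ⧸ (maximalIdeal R • ⊤ : Submodule R (N →ₗ[R] N))) ≤
      n * n := by
    let S := Submodule.torsionBySet R N (maximalIdeal R)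
    let ρ : (N →ₗ[R] N) →ₗ[R] (S →ₗ[R] N) := LinearMap.lcomp R N S.subtype
    have hker : LinearMap.ker ρ ≤ (maximalIdeal R • ⊤ : Submodule R (N →ₗ[R] N)) := by
      intro φ hφ
      refine mem_smul_top_of_socle_le_ker φ fun m hm => ?_
      exact LinearMap.congr_fun hφ ⟨m, (Submodule.mem_torsionBySet_iff _ _).2 fun a => hm a a.2⟩
    calc _ ≤ Module.length R ((N →ₗ[R] N) ⧸ LinearMap.ker ρ) :=
          Module.length_le_of_surjective (Submodule.factor hker) (Submodule.factor_surjective hker)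
      _ ≤ Module.length R (S →ₗ[R] N) := by
          refine Module.length_le_of_injective ((LinearMap.ker ρ).liftQ ρ le_rfl) ?_
          rw [← LinearMap.ker_eq_bot]
          exact Submodule.ker_liftQ_eq_bot _ _ _ le_rfl
      _ = n * n := by
          rw [length_hom_eq_of_injective, length_socle_eq]
  have h2 : Module.length R N = n * Module.length R R := by
    rw [← length_hom_eq_of_injective]
    exact (LinearMap.ringLmapEquivSelf R R N).length_eq.symm
  have h3 : Module.length R (N →ₗ[R] N) = n * n * Module.length R R := by
    rw [length_hom_eq_of_injective, h2, mul_assoc]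
  have h4 : Module.length R (Fin q → R) = q * Module.length R R := by
    simp [Module.length_pi_of_fintype]
  have h5 := Module.length_eq_add_of_exact (LinearMap.ker g).subtype g
    (Submodule.subtype_injective _) hg (LinearMap.exact_subtype_ker_map g)
  have h6 : Module.length R (Fin q → R) ≤ Module.length R (N →ₗ[R] N) := by
    rw [h3, h4]
    exact mul_le_mul_left (hq.trans h1) _
  have h7 : Module.length R (N →ₗ[R] N) ≠ ⊤ := Module.length_ne_top
  have h8 : Module.length R (LinearMap.ker g) = 0 := by
    rw [h5] at h6
    rw [← nonpos_iff_eq_zero]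
    exact (ENat.add_le_add_iff_right h7).1 (by simpa using h6)
  have h9 : Subsingleton (LinearMap.ker g) := Module.length_eq_zero_iff.1 h8
  refine ⟨q, ⟨LinearEquiv.ofBijective g ⟨?_, hg⟩⟩⟩
  rw [← LinearMap.ker_eq_bot]
  exact (Submodule.subsingleton_iff_eq_bot).1 h9

/-- If a finitely generated injective module `N` embeds in `End B` with the identity in its image,
then `B` has a free summand of rank one. -/
theorem exists_surjective_of_injective_endo [Module.Injective R N] {B : Type} [AddCommGroup B]
    [Module R B] [Module.Finite R B] [Nontrivial B] (ι : N →ₗ[R] (B →ₗ[R] B))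
    (hι : Function.Injective ι) {e : N} (he : ι e = LinearMap.id) :
    ∃ g : B →ₗ[R] R, Function.Surjective g := by
  have hN : Nontrivial N := by
    refine ⟨e, 0, ?_⟩
    rintro rfl
    obtain ⟨b, hb⟩ := exists_ne (0 : B)
    rw [map_zero] at he
    exact hb (LinearMap.congr_fun he b).symm
  have : IsArtinianRing R := isArtinianRing_of_injective (R := R) (N := N)
  obtain ⟨s, hs0, hs⟩ := exists_socle_ne_zero_of_injective (R := R) (N := N)
  obtain ⟨q, ⟨E⟩⟩ := exists_equiv_fin_end_of_injective (R := R) (N := N)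
  obtain ⟨r, b, hb⟩ := Module.Finite.exists_fin (R := R) (M := B)
  let j : R →ₗ[R] (Fin r → B) := LinearMap.pi fun i => LinearMap.toSpanSingleton R B (b i)
  have hj : Function.Injective j := by
    rw [injective_iff_map_eq_zero]
    intro a ha
    have ha' : ∀ i, a • b i = 0 := fun i => congrFun ha i
    have haB : ∀ x : B, a • x = 0 := by
      intro x
      have hx : x ∈ Submodule.span R (Set.range b) := by rw [hb]; trivial
      induction hx using Submodule.span_induction with
      | mem x hx => obtain ⟨i, rfl⟩ := hx; exact ha' i
      | zero => simp
      | add x y _ _ hx hy => rw [smul_add, hx, hy, add_zero]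
      | smul c x _ hx => rw [smul_comm, hx, smul_zero]
    refine eq_zero_of_injective_of_annihilates hs0 hs fun n => hι ?_
    ext x
    simp [haB]
  obtain ⟨n, hn⟩ : ∃ n : N, n ∉ (maximalIdeal R • ⊤ : Submodule R N) := by
    by_contra! hall
    have := Submodule.eq_bot_of_le_smul_of_le_jacobson_bot (maximalIdeal R) (⊤ : Submodule R N)
      Module.Finite.fg_top (fun n _ => hall n) (maximalIdeal_le_jacobson ⊥)
    exact bot_ne_top this.symm
  obtain ⟨Ψ, hΨ⟩ := Module.Injective.out j hj (LinearMap.toSpanSingleton R N n)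
  obtain ⟨f, β, hfβ⟩ : ∃ (f : B →ₗ[R] N) (β : B), f β ∉ (maximalIdeal R • ⊤ : Submodule R N) := by
    by_contra! hall
    apply hn
    have h1 := hΨ 1
    rw [LinearMap.toSpanSingleton_apply, one_smul] at h1
    rw [← h1, map_eq_sum_single]
    exact Submodule.sum_mem _ fun i _ => hall (Ψ ∘ₗ LinearMap.single R (fun _ => B) i) _
  let h : B →ₗ[R] (N →ₗ[R] N) :=
    { toFun := fun x => f ∘ₗ (LinearMap.applyₗ x ∘ₗ ι)
      map_add' := fun x y => by ext; simp
      map_smul' := fun c x => by ext; simp }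
  have hh : h β e = f β := by simp [h, he]
  obtain ⟨i, hi⟩ : ∃ i, E.symm (h β) i ∉ maximalIdeal R := by
    by_contra! hall
    apply hfβ
    have h1 : h β ∈ (maximalIdeal R • ⊤ : Submodule R (N →ₗ[R] N)) := by
      have h2 : h β = ∑ i, E.symm (h β) i • E (Pi.single i 1) := by
        conv_lhs => rw [← E.apply_symm_apply (h β), pi_eq_sum_univ' (E.symm (h β))]
        simp
      rw [h2]
      exact Submodule.sum_mem _ fun i _ => Submodule.smul_mem_smul (hall i) trivial
    have h3 : ∀ ψ ∈ (maximalIdeal R • ⊤ : Submodule R (N →ₗ[R] N)),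
        ψ e ∈ (maximalIdeal R • ⊤ : Submodule R N) := by
      intro ψ hψ
      induction hψ using Submodule.smul_induction_on' with
      | smul a ha ψ _ => exact Submodule.smul_mem_smul ha trivial
      | add x _ y _ hx hy => exact add_mem hx hy
    rw [← hh]
    exact h3 _ h1
  have hu : IsUnit (E.symm (h β) i) := by
    by_contra hu
    exact hi hu
  obtain ⟨w, hw⟩ := hu
  refine ⟨LinearMap.proj i ∘ₗ E.symm.toLinearMap ∘ₗ h, fun a => ⟨(a * ↑w⁻¹) • β, ?_⟩⟩
  simp [← hw]

end InjectiveLength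

section RegularElement

open IsLocalRing

theorem WithBot.le_of_add_one_le_succ {s : WithBot ℕ∞} {e : ℕ} (h : s + 1 ≤ (e + 1 : ℕ)) :
    s ≤ e := by
  induction s with
  | bot => simp
  | coe s =>
    have h1 : ((s + 1 : ℕ∞) : WithBot ℕ∞) ≤ ((e + 1 : ℕ) : ℕ∞) := h
    have h2 : s + 1 ≤ (e : ℕ∞) + 1 := by exact_mod_cast h1
    have h3 : s ≤ (e : ℕ∞) := (ENat.add_le_add_iff_right (by simp)).1 h2
    exact_mod_cast h3

theorem WithBot.eq_bot_of_add_one_le_zero {s : WithBot ℕ∞} (h : s + 1 ≤ 0) : s = ⊥ := by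
  induction s with
  | bot => rfl
  | coe s =>
    have h1 : ((s + 1 : ℕ∞) : WithBot ℕ∞) ≤ (0 : ℕ∞) := h
    have h2 : s + 1 ≤ 0 := by exact_mod_cast h1
    simp at h2

variable {R : Type} [CommRing R] {A : Type} [AddCommGroup A] [Module R A]

open scoped Pointwise in
theorem exact_lsmul_mkQ (x : R) :
    Function.Exact (LinearMap.lsmul R A x) (x • ⊤ : Submodule R A).mkQ := by
  intro a
  rw [Submodule.mkQ_apply, Submodule.Quotient.mk_eq_zero, Submodule.mem_smul_pointwise_iff_exists]
  simp

theorem exists_isSMulRegular_or_exists_injective [IsNoetherianRing R] [IsLocalRing R]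
    [Module.Finite R A] :
    (∃ x ∈ maximalIdeal R, IsSMulRegular A x) ∨
      ∃ c : R ⧸ maximalIdeal R →ₗ[R] A, Function.Injective c := by
  by_cases h : (maximalIdeal R : Set R) ⊆ ⋃ p ∈ associatedPrimes R A, (p : Set R)
  · right
    obtain ⟨p, hp, hle⟩ := (Ideal.subset_union_prime_finite (associatedPrimes.finite R A)
      (f := id) 0 0 fun _ h _ _ => h.1).1 h
    obtain ⟨hp', a, ha⟩ := isAssociatedPrime_iff.1 hp
    have hpm : p = maximalIdeal R := le_antisymm (le_maximalIdeal hp'.ne_top) hle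
    subst hpm
    have hk : LinearMap.ker (LinearMap.toSpanSingleton R A a) = maximalIdeal R := by
      rw [ha]
      ext r
      simp [Submodule.mem_colon_singleton]
    refine ⟨(maximalIdeal R).liftQ (LinearMap.toSpanSingleton R A a) hk.ge, ?_⟩
    rw [← LinearMap.ker_eq_bot]
    exact Submodule.ker_liftQ_eq_bot _ _ _ hk.le
  · left
    rw [biUnion_associatedPrimes_eq_compl_regular, Set.not_subset] at h
    obtain ⟨x, hx, hx'⟩ := h
    exact ⟨x, hx, by simpa using hx'⟩

theorem subsingleton_of_subsingleton_quotSMulTop [IsLocalRing R] [Module.Finite R A] {x : R}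
    (hx : x ∈ maximalIdeal R) (h : Subsingleton (QuotSMulTop x A)) : Subsingleton A := by
  rw [Submodule.Quotient.subsingleton_iff] at h
  have : (⊤ : Submodule R A) = ⊥ := by
    refine Submodule.eq_bot_of_le_smul_of_le_jacobson_bot (maximalIdeal R) _
      Module.Finite.fg_top ?_ (maximalIdeal_le_jacobson ⊥)
    intro a ha
    rw [← h] at ha
    obtain ⟨b, -, rfl⟩ := Submodule.mem_smul_pointwise_iff_exists _ _ _ |>.1 ha
    exact Submodule.smul_mem_smul hx trivial
  exact (Submodule.subsingleton_iff R).1 (subsingleton_of_bot_eq_top this.symm)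

theorem nontrivial_quotSMulTop [IsLocalRing R] [Module.Finite R A] [Nontrivial A] {x : R}
    (hx : x ∈ maximalIdeal R) : Nontrivial (QuotSMulTop x A) := by
  by_contra h
  exact not_subsingleton A (subsingleton_of_subsingleton_quotSMulTop hx
    (not_nontrivial_iff_subsingleton.1 h))

end RegularElement

section InjectiveDimension

open IsLocalRing

variable {R : Type} [CommRing R]

/-- All `Ext` groups from finitely generated modules into `N` vanish in degrees above `n`. -/
def InjDimLE (R : Type) [CommRing R] (n : ℕ) (N : Type) [AddCommGroup N] [Module R N] : Prop :=
  ∀ (L : Type) [AddCommGroup L] [Module R L], Module.Finite R L → ∀ i, n < i → ExtVanishes R i L N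

variable {N : Type} [AddCommGroup N] [Module R N]

variable [IsNoetherianRing R] [IsLocalRing R] [Module.Finite R N]

theorem extVanishes_of_extVanishes_residueField {n : ℕ}
    (H : ∀ (L : Type) [AddCommGroup L] [Module R L], Module.Finite R L → ExtVanishes R (n + 1) L N)
    (hk : ExtVanishes R n (R ⧸ maximalIdeal R) N) (L : Type) [AddCommGroup L] [Module R L]
    [Module.Finite R L] : ExtVanishes R n L N := by
  induction ‹Module.Finite R L› using
    IsNoetherianRing.induction_on_isQuotientEquivQuotientPrime R with
  | subsingleton L => exact extVanishes_of_subsingleton_left n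
  | quotient L p e =>
    refine extVanishes_of_retract_left e.toLinearMap e.symm.toLinearMap (by ext; simp) ?_
    by_cases hp : p.1 = maximalIdeal R
    · rwa [hp]
    · obtain ⟨y, hy, hyp⟩ := SetLike.exists_of_lt
        (lt_of_le_of_ne (le_maximalIdeal p.2.ne_top) hp)
      refine extVanishes_of_smul_regular_left hy (f := LinearMap.lsmul R _ y) (fun _ => rfl) ?_
        (Submodule.mkQ_surjective _) (exact_lsmul_mkQ y) (H _ inferInstance)
      rw [injective_iff_map_eq_zero]
      intro a ha
      obtain ⟨a, rfl⟩ := Ideal.Quotient.mk_surjective a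
      have : Ideal.Quotient.mk p.1 (y * a) = 0 := ha
      rw [Ideal.Quotient.eq_zero_iff_mem] at this ⊢
      exact (p.2.mem_or_mem this).resolve_left hyp
  | exact A B C f g hf hg hfg hA hC => exact extVanishes_left_mid hf hg hfg hA hC

omit [Module.Finite R N] in
theorem exists_residueField_embedding_extVanishes (e : ℕ) : ∀ (j : ℕ) (A : Type) [AddCommGroup A]
    [Module R A] [Module.Finite R A] [Nontrivial A], Module.supportDim R A ≤ e →
    (∀ i, j < i → ExtVanishes R i A N) →
    ∃ (L : Type) (_ : AddCommGroup L) (_ : Module R L) (c : R ⧸ maximalIdeal R →ₗ[R] L),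
      Module.Finite R L ∧ Function.Injective c ∧ ∀ i, j + e < i → ExtVanishes R i L N := by
  induction e with
  | zero =>
    intro j A _ _ _ _ hA H
    rcases exists_isSMulRegular_or_exists_injective (R := R) (A := A) with ⟨x, hx, hreg⟩ | ⟨c, hc⟩
    · exfalso
      have h1 := Module.supportDim_quotSMulTop_succ_eq_supportDim hreg hx
      have h2 : Nontrivial (QuotSMulTop x A) := nontrivial_quotSMulTop hx
      exact Module.supportDim_ne_bot_of_nontrivial R (QuotSMulTop x A)
        (WithBot.eq_bot_of_add_one_le_zero (h1.trans_le hA))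
    · exact ⟨A, _, _, c, inferInstance, hc, by simpa using H⟩
  | succ e ih =>
    intro j A _ _ _ _ hA H
    rcases exists_isSMulRegular_or_exists_injective (R := R) (A := A) with ⟨x, hx, hreg⟩ | ⟨c, hc⟩
    · have h1 := Module.supportDim_quotSMulTop_succ_eq_supportDim hreg hx
      have h2 : Nontrivial (QuotSMulTop x A) := nontrivial_quotSMulTop hx
      have h3 : Module.supportDim R (QuotSMulTop x A) ≤ e :=
        WithBot.le_of_add_one_le_succ (h1.trans_le hA)
      obtain ⟨L, _, _, c, hL, hc, hi⟩ := ih (j + 1) (QuotSMulTop x A) h3 (by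
        intro i hi
        obtain ⟨i, rfl⟩ : ∃ i', i = i' + 1 := ⟨i - 1, by omega⟩
        exact extVanishes_left_lst (f := LinearMap.lsmul R A x) hreg (Submodule.mkQ_surjective _)
          (exact_lsmul_mkQ x) (H i (by omega)) (H (i + 1) (by omega)))
      exact ⟨L, _, _, c, hL, hc, fun i h => hi i (by omega)⟩
    · exact ⟨A, _, _, c, inferInstance, hc, fun i h => H i (by omega)⟩

theorem InjDimLE.of_extVanishes_of_injective {n j : ℕ} (hN : InjDimLE R n N) {L : Type}
    [AddCommGroup L] [Module R L] [Module.Finite R L] {c : R ⧸ maximalIdeal R →ₗ[R] L}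
    (hc : Function.Injective c) (hL : ∀ i, j < i → ExtVanishes R i L N) : InjDimLE R j N := by
  induction n with
  | zero => exact fun A _ _ hA i hi => hN A hA i (by omega)
  | succ n ih =>
    by_cases h : n + 1 ≤ j
    · exact fun A _ _ hA i hi => hN A hA i (by omega)
    · refine ih fun A _ _ _ i hi => ?_
      rcases Nat.lt_or_ge (n + 1) i with h' | h'
      · exact hN A inferInstance i h'
      · obtain rfl : i = n + 1 := by omega
        refine extVanishes_of_extVanishes_residueField
          (fun B _ _ hB => hN B hB _ (by omega)) ?_ A
        exact extVanishes_left_fst hc (Submodule.mkQ_surjective _)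
          (LinearMap.exact_map_mkQ_range c) (hL _ (by omega))
          (hN _ inferInstance _ (by omega))

/-- Finite injective dimension is at most the Krull dimension. -/
theorem InjDimLE.of_ringKrullDim_le {n d : ℕ} (hN : InjDimLE R n N) (hd : ringKrullDim R ≤ d) :
    InjDimLE R d N := by
  obtain ⟨L, _, _, c, hL, hc, h⟩ := exists_residueField_embedding_extVanishes (R := R) (N := N) d 0
    R (by rwa [Module.supportDim_self_eq_ringKrullDim]) fun i hi => by
      obtain ⟨i, rfl⟩ : ∃ i', i = i' + 1 := ⟨i - 1, by omega⟩
      exact extVanishes_of_projective i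
  exact hN.of_extVanishes_of_injective hc (by simpa using h)

omit [IsNoetherianRing R] [IsLocalRing R] [Module.Finite R N] in
theorem InjDimLE.injective (hN : InjDimLE R 0 N) : Module.Injective R N := by
  refine Module.Baer.injective fun I u => ?_
  obtain ⟨v, hv⟩ := exists_extension_of_extVanishes (Submodule.subtype_injective I)
    (Submodule.mkQ_surjective I) (LinearMap.exact_subtype_mkQ I)
    (hN (R ⧸ I) inferInstance 1 one_pos) u
  exact ⟨v, fun a ha => LinearMap.congr_fun hv ⟨a, ha⟩⟩

theorem InjDimLE.injective_of_residueField_embedding {n : ℕ} (hN : InjDimLE R n N)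
    {c : R ⧸ maximalIdeal R →ₗ[R] R} (hc : Function.Injective c) : Module.Injective R N := by
  refine InjDimLE.injective (hN.of_extVanishes_of_injective hc fun i hi => ?_)
  obtain ⟨i, rfl⟩ : ∃ i', i = i' + 1 := ⟨i - 1, by omega⟩
  exact extVanishes_of_projective i

end InjectiveDimension

section Torsionless

variable {R : Type} [CommRing R] [IsNoetherianRing R]

theorem exists_fin_surjective_ker {A B : Type} [AddCommGroup A] [Module R A] [AddCommGroup B]
    [Module R B] [Module.Finite R A] (g : A →ₗ[R] B) :
    ∃ (n : ℕ) (f : (Fin n → R) →ₗ[R] A), LinearMap.range f = LinearMap.ker g := by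
  obtain ⟨n, f, hf⟩ := Module.Finite.exists_fin' R (LinearMap.ker g)
  refine ⟨n, (LinearMap.ker g).subtype ∘ₗ f, ?_⟩
  rw [LinearMap.range_comp, LinearMap.range_eq_top.2 hf, Submodule.map_top, Submodule.range_subtype]

variable {N : Type} [AddCommGroup N] [Module R N]

theorem extVanishes_dual_coker {d : ℕ} (hN : InjDimLE R d N) (e : ℕ) :
    ∀ {M : Type} [AddCommGroup M] [Module R M] [Module.Finite R M] {n m : ℕ}
      {f : (Fin m → R) →ₗ[R] (Fin n → R)} {π : (Fin n → R) →ₗ[R] M},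
      Function.Surjective π → LinearMap.range f = LinearMap.ker π →
      (∀ j, 1 ≤ j → j ≤ e → ExtVanishes R j M R) →
      ∀ i, 1 ≤ i → d < i + e →
        ExtVanishes R i (((Fin m → R) →ₗ[R] R) ⧸ LinearMap.range (LinearMap.lcomp R R f)) N := by
  induction e with
  | zero => exact fun _ _ _ i _ hi => hN _ inferInstance i hi
  | succ e ih =>
    intro M _ _ _ n m f π hπ hf hM i hi hd
    obtain ⟨l, g, hg⟩ := exists_fin_surjective_ker f
    have hex : Function.Exact (LinearMap.range f).subtype π := by
      rw [LinearMap.exact_iff, Submodule.range_subtype, hf]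
    have h1 := ih (M := LinearMap.range f) (f := g) (π := f.rangeRestrict)
      f.surjective_rangeRestrict (by rw [f.ker_rangeRestrict, hg]) (fun j hj hje => by
        obtain ⟨j, rfl⟩ : ∃ j', j = j' + 1 := ⟨j - 1, by omega⟩
        exact (extVanishes_succ_iff_of_projective (Submodule.subtype_injective _) hπ hex j).1
          (hM (j + 2) (by omega) (by omega)))
      (i + 1) (by omega) (by omega)
    have hk : LinearMap.range (LinearMap.lcomp R R f) ≤ LinearMap.ker (LinearMap.lcomp R R g) := by
      rintro _ ⟨h, rfl⟩
      ext a
      have : f (g (Pi.single a 1)) = 0 := by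
        have : g (Pi.single a 1) ∈ LinearMap.ker f := hg ▸ ⟨_, rfl⟩
        exact this
      simp [this]
    have hk' : LinearMap.ker (LinearMap.lcomp R R g) ≤ LinearMap.range (LinearMap.lcomp R R f) := by
      intro h hh
      obtain ⟨h', hh'⟩ := exists_comp_eq_of_ker_le f.surjective_rangeRestrict (u := h) (by
        rw [f.ker_rangeRestrict, ← hg]
        rintro _ ⟨a, rfl⟩
        exact LinearMap.congr_fun hh a)
      obtain ⟨v, hv⟩ := exists_extension_of_extVanishes (Submodule.subtype_injective _) hπ hex
        (hM 1 le_rfl (by omega)) h'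
      refine ⟨v, ?_⟩
      rw [← hh', ← hv]
      rfl
    obtain ⟨i, rfl⟩ : ∃ i', i = i' + 1 := ⟨i - 1, by omega⟩
    refine extVanishes_left_fst
      (f := (LinearMap.range (LinearMap.lcomp R R f)).liftQ (LinearMap.lcomp R R g) hk)
      (g := (LinearMap.range (LinearMap.lcomp R R g)).mkQ) ?_ (Submodule.mkQ_surjective _) ?_
      (extVanishes_of_projective i) h1
    · rw [← LinearMap.ker_eq_bot]
      exact Submodule.ker_liftQ_eq_bot _ _ _ hk'
    · rw [LinearMap.exact_iff, Submodule.ker_mkQ, Submodule.range_liftQ]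

/-- If a module `N` of injective dimension at most `d` acts on `M` with some element acting as
the identity, and `Ext^j(M, R) = 0` for `1 ≤ j ≤ d`, then `M` is torsionless. -/
theorem eq_zero_of_forall_dual_eq_zero {d : ℕ} (hN : InjDimLE R d N) {M : Type} [AddCommGroup M]
    [Module R M] [Module.Finite R M] (hM : ∀ j, 1 ≤ j → j ≤ d → ExtVanishes R j M R)
    (ι : N →ₗ[R] (M →ₗ[R] M)) {e : N} (he : ι e = LinearMap.id) {x : M}
    (hx : ∀ g : M →ₗ[R] R, g x = 0) : x = 0 := by
  obtain ⟨n, π, hπ⟩ := Module.Finite.exists_fin' R M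
  obtain ⟨m, f, hf⟩ := exists_fin_surjective_ker π
  have hE := extVanishes_dual_coker hN d hπ hf hM 1 le_rfl (by omega)
  obtain ⟨u, rfl⟩ := hπ x
  let ρ : ((Fin n → R) →ₗ[R] R) →ₗ[R] LinearMap.range (LinearMap.lcomp R R f) :=
    (LinearMap.lcomp R R f).rangeRestrict
  have hρ : Function.Surjective ρ := LinearMap.surjective_rangeRestrict _
  obtain ⟨θ, hθ⟩ := exists_comp_eq_of_ker_le
    (B := LinearMap.range (LinearMap.lcomp R R f)) (g := ρ) hρ
    (u := LinearMap.toSpanSingleton R N e ∘ₗ LinearMap.applyₗ u) (by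
      rw [LinearMap.ker_rangeRestrict]
      intro g hg
      obtain ⟨g', rfl⟩ := exists_comp_eq_of_ker_le hπ (u := g) (by
        rw [← hf]
        rintro _ ⟨a, rfl⟩
        exact LinearMap.congr_fun hg a)
      have := hx g'
      simp [this])
  obtain ⟨Θ, hΘ⟩ := exists_extension_of_extVanishes (Submodule.subtype_injective _)
    (Submodule.mkQ_surjective _) (LinearMap.exact_subtype_mkQ _) hE θ
  have h1 : ∀ g : ((Fin n → R) →ₗ[R] R), Θ (g ∘ₗ f) = g u • e := by
    intro g
    have := LinearMap.congr_fun hθ g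
    rw [← hΘ] at this
    exact this
  have h2 : ∀ i, u i • e =
      ∑ k, f (Pi.single k 1) i • Θ (LinearMap.proj k) := by
    intro i
    have h3 : (LinearMap.proj i : (Fin n → R) →ₗ[R] R) ∘ₗ f =
        ∑ k, f (Pi.single k 1) i • (LinearMap.proj k : (Fin m → R) →ₗ[R] R) := by
      ext k
      simp [Pi.single_apply]
    have h4 := h1 (LinearMap.proj i)
    rw [h3, map_sum] at h4
    simpa using h4.symm
  have h5 : ∀ v : Fin n → R, π v = ∑ i, v i • π (Pi.single i 1) := by
    intro v
    conv_lhs => rw [pi_eq_sum_univ' v]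
    simp
  calc π u = ∑ i, ι (u i • e) (π (Pi.single i 1)) := by simp [h5 u, he]
    _ = ∑ k, ι (Θ (LinearMap.proj k)) (π (f (Pi.single k 1))) := by
        simp_rw [h2, h5 (f _), map_sum, LinearMap.sum_apply]
        rw [Finset.sum_comm]
        simp
    _ = 0 := by
        refine Finset.sum_eq_zero fun k _ => ?_
        have : f (Pi.single k 1) ∈ LinearMap.ker π := hf ▸ ⟨_, rfl⟩
        rw [LinearMap.mem_ker.1 this, map_zero]

omit [IsNoetherianRing R] in
theorem isSMulRegular_of_forall_dual {M : Type} [AddCommGroup M] [Module R M]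
    (hM : ∀ x : M, (∀ g : M →ₗ[R] R, g x = 0) → x = 0) {r : R} (hr : IsSMulRegular R r) :
    IsSMulRegular M r := by
  refine IsSMulRegular.of_right_eq_zero_of_smul fun x hx => hM x fun g => hr ?_
  change r • g x = r • 0
  rw [← map_smul, hx, map_zero, smul_zero]

end Torsionless

section ChangeOfRings

open CategoryTheory.Abelian

variable {R : Type} [CommRing R] {x : R}

/-- Reduction modulo `x` of a linear map, as a map over the quotient ring. -/
def quotMap (x : R) {A B : Type} [AddCommGroup A] [Module R A] [AddCommGroup B] [Module R B]
    (f : A →ₗ[R] B) : QuotSMulTop x A →ₗ[R ⧸ Ideal.span {x}] QuotSMulTop x B :=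
  (QuotSMulTop.map x f).extendScalarsOfSurjective Ideal.Quotient.mk_surjective

section

variable {A B C : Type} [AddCommGroup A] [Module R A] [AddCommGroup B] [Module R B]
  [AddCommGroup C] [Module R C]

theorem quotMap_mk (f : A →ₗ[R] B) (a : A) :
    quotMap x f (Submodule.Quotient.mk a) = Submodule.Quotient.mk (f a) :=
  rfl

theorem quotSMulTop_mk_eq_zero_iff {a : A} :
    (Submodule.Quotient.mk a : QuotSMulTop x A) = 0 ↔ ∃ b, x • b = a := by
  rw [Submodule.Quotient.mk_eq_zero, Submodule.mem_smul_pointwise_iff_exists]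
  simp

theorem quotMap_surjective {g : B →ₗ[R] C} (hg : Function.Surjective g) :
    Function.Surjective (quotMap x g) :=
  QuotSMulTop.map_surjective x hg

theorem quotMap_exact {f : A →ₗ[R] B} {g : B →ₗ[R] C} (hg : Function.Surjective g)
    (hfg : Function.Exact f g) : Function.Exact (quotMap x f) (quotMap x g) :=
  QuotSMulTop.map_exact x hfg hg

theorem quotMap_injective {f : A →ₗ[R] B} {g : B →ₗ[R] C} (hf : Function.Injective f)
    (hfg : Function.Exact f g) (hx : IsSMulRegular C x) :
    Function.Injective (quotMap x f) := by
  rw [injective_iff_map_eq_zero]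
  intro a ha
  obtain ⟨a, rfl⟩ := Submodule.Quotient.mk_surjective _ a
  rw [quotMap_mk, quotSMulTop_mk_eq_zero_iff] at ha
  obtain ⟨b, hb⟩ := ha
  have h1 : g b = 0 := by
    refine hx ?_
    change x • g b = x • 0
    rw [← map_smul, hb, hfg.apply_apply_eq_zero, smul_zero]
  obtain ⟨c, rfl⟩ := (hfg b).1 h1
  refine quotSMulTop_mk_eq_zero_iff.2 ⟨c, hf ?_⟩
  rw [map_smul, hb]

theorem smul_eq_zero_of_quotient {Y : Type} [AddCommGroup Y] [Module R Y]
    [Module (R ⧸ Ideal.span {x}) Y] [IsScalarTower R (R ⧸ Ideal.span {x}) Y] (y : Y) :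
    x • y = 0 := by
  rw [← one_smul (R ⧸ Ideal.span {x}) y, ← smul_assoc]
  have : x • (1 : R ⧸ Ideal.span {x}) = 0 := by
    change Ideal.Quotient.mk _ (x * 1) = 0
    rw [mul_one, Ideal.Quotient.eq_zero_iff_mem]
    exact Ideal.mem_span_singleton_self x
  rw [this, zero_smul]

open scoped Pointwise in
/-- Maps to a module over the quotient ring factor through the reduction. -/
theorem exists_quotSMulTop_lift {Y : Type} [AddCommGroup Y] [Module R Y]
    [Module (R ⧸ Ideal.span {x}) Y] [IsScalarTower R (R ⧸ Ideal.span {x}) Y] (u : A →ₗ[R] Y) :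
    ∃ v : QuotSMulTop x A →ₗ[R ⧸ Ideal.span {x}] Y, ∀ a, v (Submodule.Quotient.mk a) = u a := by
  refine ⟨((x • ⊤ : Submodule R A).liftQ u ?_).extendScalarsOfSurjective
    Ideal.Quotient.mk_surjective, fun a => rfl⟩
  intro a ha
  obtain ⟨b, rfl⟩ := quotSMulTop_mk_eq_zero_iff.1 ((Submodule.Quotient.mk_eq_zero _).2 ha)
  rw [LinearMap.mem_ker, map_smul]
  exact smul_eq_zero_of_quotient _

end

variable [IsNoetherianRing R]

theorem extVanishes_quotSMulTop_left (hxR : IsSMulRegular R x) {Y : Type} [AddCommGroup Y]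
    [Module R Y] [Module (R ⧸ Ideal.span {x}) Y] [IsScalarTower R (R ⧸ Ideal.span {x}) Y] (n : ℕ) :
    ∀ (M : Type) [AddCommGroup M] [Module R M] [Module.Finite R M], IsSMulRegular M x →
      ExtVanishes R (n + 1) M Y →
      ExtVanishes (R ⧸ Ideal.span {x}) (n + 1) (QuotSMulTop x M) Y := by
  induction n with
  | zero =>
    intro M _ _ _ hx hM
    obtain ⟨m, π, hπ⟩ := Module.Finite.exists_fin' R M
    have hex := LinearMap.exact_subtype_ker_map π
    refine extVanishes_one_of_extension
      (quotMap_injective (Submodule.subtype_injective _) hex hx)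
      (quotMap_surjective hπ) (quotMap_exact hπ hex) fun u => ?_
    obtain ⟨v, hv⟩ := exists_extension_of_extVanishes (Submodule.subtype_injective _) hπ hex hM
      ((u.restrictScalars R) ∘ₗ Submodule.mkQ _)
    obtain ⟨w, hw⟩ := exists_quotSMulTop_lift (x := x) v
    refine ⟨w, LinearMap.ext fun a => ?_⟩
    obtain ⟨a, rfl⟩ := Submodule.Quotient.mk_surjective _ a
    rw [LinearMap.comp_apply, quotMap_mk, hw]
    exact LinearMap.congr_fun hv a
  | succ n ih =>
    intro M _ _ _ hx hM
    obtain ⟨m, π, hπ⟩ := Module.Finite.exists_fin' R M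
    have hex := LinearMap.exact_subtype_ker_map π
    rw [extVanishes_succ_iff_of_projective (Submodule.subtype_injective _) hπ hex] at hM
    rw [extVanishes_succ_iff_of_projective
      (quotMap_injective (Submodule.subtype_injective _) hex hx)
      (quotMap_surjective hπ) (quotMap_exact hπ hex)]
    refine ih _ ?_ hM
    intro a b hab
    apply Subtype.ext
    funext i
    exact hxR (congrFun (congrArg Subtype.val hab) i)

variable {N : Type} [AddCommGroup N] [Module R N]

omit [IsNoetherianRing R] in
theorem extVanishes_quotSMulTop_fin (hxR : IsSMulRegular R x) (m n : ℕ) :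
    ExtVanishes R (n + 2) (QuotSMulTop x (Fin m → R)) N := by
  refine extVanishes_left_lst (f := LinearMap.lsmul R (Fin m → R) x) ?_
    (Submodule.mkQ_surjective _) (exact_lsmul_mkQ x) (extVanishes_of_projective n)
    (extVanishes_of_projective (n + 1))
  intro a b hab
  funext i
  exact hxR (congrFun hab i)

omit [IsNoetherianRing R] in
/-- If `x` kills `B` and `Ext²(C, N) = 0`, maps into `N / x N` extend along an injection into `B`
with cokernel `C`. -/
theorem exists_extension_quotSMulTop {A B C : Type} [AddCommGroup A] [Module R A]
    [AddCommGroup B] [Module R B] [AddCommGroup C] [Module R C] {f : A →ₗ[R] B} {g : B →ₗ[R] C}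
    (hf : Function.Injective f) (hg : Function.Surjective g) (hfg : Function.Exact f g)
    (hxN : IsSMulRegular N x) (hB : ∀ b : B, x • b = 0) (hC : ExtVanishes R 2 C N)
    (u : A →ₗ[R] QuotSMulTop x N) : ∃ v : B →ₗ[R] QuotSMulTop x N, v ∘ₗ f = u := by
  have hS := shortExact_of_exact hf hg hfg
  have hT := shortExact_of_exact (f := LinearMap.lsmul R N x) hxN
    (Submodule.mkQ_surjective _) (exact_lsmul_mkQ x)
  obtain ⟨β, hβ⟩ := Ext.contravariant_sequence_exact₁ hS (ModuleCat.of R N)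
    ((Ext.mk₀ (ModuleCat.ofHom u)).comp hT.extClass (zero_add 1)) (add_comm 1 1) (hC.elim _ _)
  have h1 : β.comp (Ext.mk₀ (ModuleCat.ofHom (LinearMap.lsmul R N x))) (add_zero 1) = 0 := by
    have h2 : ModuleCat.ofHom (LinearMap.lsmul R N x) = x • 𝟙 (ModuleCat.of R N) := by
      ext a; simp
    have h3 : x • 𝟙 (ModuleCat.of R B) = 0 := by
      ext b
      simpa using hB b
    have h4 : x • β = 0 := by
      rw [← Ext.mk₀_id_comp β, ← Ext.smul_comp, ← Ext.mk₀_smul, h3, Ext.mk₀_zero, Ext.zero_comp]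
    rw [h2, Ext.mk₀_smul, Ext.comp_smul, Ext.comp_mk₀_id, h4]
  obtain ⟨γ, hγ⟩ := Ext.covariant_sequence_exact₁ (ModuleCat.of R B) hT β h1 rfl
  obtain ⟨v, rfl⟩ := (Ext.mk₀_bijective _ _).2 γ
  refine ⟨v.hom, ?_⟩
  have h5 : (Ext.mk₀ (ModuleCat.ofHom f ≫ v - ModuleCat.ofHom u)).comp hT.extClass
      (zero_add 1) = 0 := by
    rw [sub_eq_add_neg, Ext.mk₀_add, Ext.mk₀_neg, Ext.add_comp, Ext.neg_comp, ← sub_eq_add_neg,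
      sub_eq_zero, ← Ext.mk₀_comp_mk₀]
    have h6 : (Ext.mk₀ (ModuleCat.ofHom f)).comp β (zero_add 1) =
        (Ext.mk₀ (ModuleCat.ofHom u)).comp hT.extClass (zero_add 1) := hβ
    have h7 : (Ext.mk₀ v).comp hT.extClass (zero_add 1) = β := hγ
    rw [← h6, ← h7]
    exact Ext.comp_assoc _ _ _ (zero_add 0) (zero_add 1) (by simp)
  obtain ⟨ω, hω⟩ := Ext.covariant_sequence_exact₃ (ModuleCat.of R A) hT _ (zero_add 1) h5
  obtain ⟨w, rfl⟩ := (Ext.mk₀_bijective _ _).2 ω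
  have h6 := (Ext.mk₀_bijective _ _).1 ((Ext.mk₀_comp_mk₀ _ _).symm.trans hω)
  ext a
  have h7 : w.hom a = 0 := by
    refine hxN ?_
    change x • w.hom a = x • 0
    have h8 : x • a = 0 := hf (by rw [map_smul, hB, map_zero])
    rw [← map_smul, h8, map_zero, smul_zero]
  have h9 := LinearMap.congr_fun (ModuleCat.hom_ext_iff.1 h6) a
  change Submodule.mkQ _ (w.hom a) = v.hom (f a) - u a at h9
  rw [h7, map_zero] at h9
  exact sub_eq_zero.1 h9.symm

theorem extVanishes_quotSMulTop_right (hxR : IsSMulRegular R x) (hxN : IsSMulRegular N x) (n : ℕ) :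
    ∀ (L : Type) [AddCommGroup L] [Module R L] [Module (R ⧸ Ideal.span {x}) L]
      [IsScalarTower R (R ⧸ Ideal.span {x}) L] [Module.Finite R L],
      ExtVanishes R (n + 2) L N →
      ExtVanishes (R ⧸ Ideal.span {x}) (n + 1) L (QuotSMulTop x N) := by
  induction n with
  | zero =>
    intro L _ _ _ _ _ hL
    obtain ⟨m, π, hπ⟩ := Module.Finite.exists_fin' R L
    obtain ⟨p, hp⟩ := exists_quotSMulTop_lift (x := x) π
    have hps : Function.Surjective p := fun l => by
      obtain ⟨a, rfl⟩ := hπ l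
      exact ⟨_, hp a⟩
    have hex := LinearMap.exact_subtype_ker_map p
    refine extVanishes_one_of_extension (Submodule.subtype_injective _) hps hex fun u => ?_
    obtain ⟨v, hv⟩ := exists_extension_quotSMulTop
      (f := (LinearMap.ker p).subtype.restrictScalars R) (g := p.restrictScalars R)
      (Submodule.subtype_injective _) hps hex hxN (fun b => smul_eq_zero_of_quotient b) hL
      (u.restrictScalars R)
    refine ⟨v.extendScalarsOfSurjective Ideal.Quotient.mk_surjective, LinearMap.ext fun a => ?_⟩
    exact LinearMap.congr_fun hv a
  | succ n ih =>
    intro L _ _ _ _ _ hL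
    obtain ⟨m, π, hπ⟩ := Module.Finite.exists_fin' R L
    obtain ⟨p, hp⟩ := exists_quotSMulTop_lift (x := x) π
    have hps : Function.Surjective p := fun l => by
      obtain ⟨a, rfl⟩ := hπ l
      exact ⟨_, hp a⟩
    have hex := LinearMap.exact_subtype_ker_map p
    rw [extVanishes_succ_iff_of_projective (Submodule.subtype_injective _) hps hex]
    have : IsNoetherian R (QuotSMulTop x (Fin m → R)) := inferInstance
    have : Module.Finite R (LinearMap.ker p) :=
      Module.Finite.of_injective ((LinearMap.ker p).subtype.restrictScalars R)
        (Submodule.subtype_injective _)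
    refine ih _ ?_
    exact extVanishes_left_fst (f := (LinearMap.ker p).subtype.restrictScalars R)
      (g := p.restrictScalars R) (Submodule.subtype_injective _) hps hex
      (extVanishes_quotSMulTop_fin hxR m n) hL

theorem InjDimLE.quotSMulTop {n : ℕ} (hN : InjDimLE R n N) (hxR : IsSMulRegular R x)
    (hxN : IsSMulRegular N x) : InjDimLE (R ⧸ Ideal.span {x}) n (QuotSMulTop x N) := by
  intro L _ _ _ i hi
  let : Module R L := Module.compHom L (Ideal.Quotient.mk (Ideal.span {x}))
  have : IsScalarTower R (R ⧸ Ideal.span {x}) L := ⟨fun a b l => by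
    rw [Algebra.smul_def]
    exact mul_smul (Ideal.Quotient.mk (Ideal.span {x}) a) b l⟩
  have : Module.Finite R L := Module.Finite.trans (R ⧸ Ideal.span {x}) L
  obtain ⟨i, rfl⟩ : ∃ i', i = i' + 1 := ⟨i - 1, by omega⟩
  exact extVanishes_quotSMulTop_right hxR hxN i L (hN L this (i + 2) (by omega))

end ChangeOfRings

section Core

open IsLocalRing

section

variable {R : Type} [CommRing R] {x : R} {M N : Type} [AddCommGroup M] [Module R M]
  [AddCommGroup N] [Module R N]

theorem lsmul_injective (hx : IsSMulRegular M x) : Function.Injective (LinearMap.lsmul R M x) :=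
  hx

theorem quotMap_add (f g : M →ₗ[R] N) : quotMap x (f + g) = quotMap x f + quotMap x g := by
  refine LinearMap.ext fun m => ?_
  obtain ⟨m, rfl⟩ := Submodule.Quotient.mk_surjective _ m
  rfl

theorem quotMap_smul (c : R) (f : M →ₗ[R] N) : quotMap x (c • f) = c • quotMap x f := by
  refine LinearMap.ext fun m => ?_
  obtain ⟨m, rfl⟩ := Submodule.Quotient.mk_surjective _ m
  rfl

theorem quotMap_id : quotMap x (LinearMap.id : M →ₗ[R] M) = LinearMap.id := by
  refine LinearMap.ext fun m => ?_
  obtain ⟨m, rfl⟩ := Submodule.Quotient.mk_surjective _ m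
  rfl

/-- The linear map `f ↦ quotMap x f`. -/
def quotMapHom (x : R) (M N : Type) [AddCommGroup M] [Module R M] [AddCommGroup N] [Module R N] :
    (M →ₗ[R] N) →ₗ[R] (QuotSMulTop x M →ₗ[R ⧸ Ideal.span {x}] QuotSMulTop x N) where
  toFun := quotMap x
  map_add' := quotMap_add
  map_smul' := quotMap_smul

/-- The action of `N` on `M` induces an action of `N / x N` on `M / x M`. -/
theorem exists_endo_quotSMulTop (x : R) (ι : N →ₗ[R] (M →ₗ[R] M)) :
    ∃ κ : QuotSMulTop x N →ₗ[R ⧸ Ideal.span {x}]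
        (QuotSMulTop x M →ₗ[R ⧸ Ideal.span {x}] QuotSMulTop x M),
      ∀ n, κ (Submodule.Quotient.mk n) = quotMap x (ι n) :=
  exists_quotSMulTop_lift (quotMapHom x M M ∘ₗ ι)

theorem exists_smul_eq_of_forall_exists {A : Type} [AddCommGroup A] [Module R A]
    (hx : IsSMulRegular M x) (f : A →ₗ[R] M)
    (h : ∀ a, ∃ b, x • b = f a) : ∃ φ : A →ₗ[R] M, x • φ = f := by
  choose φ hφ using h
  refine ⟨⟨⟨φ, fun a b => hx ?_⟩, fun c a => hx ?_⟩, LinearMap.ext hφ⟩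
  · simp [hφ]
  · simp [hφ, smul_comm x c]

variable {ι : N →ₗ[R] (M →ₗ[R] M)} {κ : QuotSMulTop x N →ₗ[R ⧸ Ideal.span {x}]
    (QuotSMulTop x M →ₗ[R ⧸ Ideal.span {x}] QuotSMulTop x M)}

theorem injective_endo_quotSMulTop (hκ : ∀ n, κ (Submodule.Quotient.mk n) = quotMap x (ι n))
    (hxM : IsSMulRegular M x) (hι : Function.Bijective ι) : Function.Injective κ := by
  rw [injective_iff_map_eq_zero]
  intro a ha
  obtain ⟨a, rfl⟩ := Submodule.Quotient.mk_surjective _ a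
  rw [hκ] at ha
  obtain ⟨φ, hφ⟩ := exists_smul_eq_of_forall_exists hxM (ι a) fun m =>
    quotSMulTop_mk_eq_zero_iff.1 (LinearMap.congr_fun ha (Submodule.Quotient.mk m))
  obtain ⟨b, rfl⟩ := hι.2 φ
  rw [← map_smul] at hφ
  exact quotSMulTop_mk_eq_zero_iff.2 ⟨b, hι.1 hφ⟩

theorem exists_quotMap_eq (hxM : IsSMulRegular N x) (hM : ExtVanishes R 1 M N)
    (u : QuotSMulTop x M →ₗ[R ⧸ Ideal.span {x}] QuotSMulTop x N) :
    ∃ v : M →ₗ[R] N, quotMap x v = u := by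
  obtain ⟨v, hv⟩ := exists_lift_of_extVanishes (lsmul_injective hxM)
    (Submodule.mkQ_surjective _) (exact_lsmul_mkQ x) hM (u.restrictScalars R ∘ₗ Submodule.mkQ _)
  refine ⟨v, LinearMap.ext fun m => ?_⟩
  obtain ⟨m, rfl⟩ := Submodule.Quotient.mk_surjective _ m
  exact LinearMap.congr_fun hv m

theorem surjective_endo_quotSMulTop (hκ : ∀ n, κ (Submodule.Quotient.mk n) = quotMap x (ι n))
    (hxM : IsSMulRegular M x) (hι : Function.Surjective ι) (hM : ExtVanishes R 1 M M) :
    Function.Surjective κ := fun u => by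
  obtain ⟨v, rfl⟩ := exists_quotMap_eq hxM hM u
  obtain ⟨b, rfl⟩ := hι v
  exact ⟨_, hκ b⟩

theorem extVanishes_quotSMulTop [IsNoetherianRing R] [Module.Finite R M]
    (hxR : IsSMulRegular R x) (hxM : IsSMulRegular M x) (hxN : IsSMulRegular N x) {n : ℕ}
    (h1 : ExtVanishes R (n + 1) M N) (h2 : ExtVanishes R (n + 2) M N) :
    ExtVanishes (R ⧸ Ideal.span {x}) (n + 1) (QuotSMulTop x M) (QuotSMulTop x N) :=
  extVanishes_quotSMulTop_left hxR n M hxM (extVanishes_right_lst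
    (lsmul_injective hxN) (Submodule.mkQ_surjective _) (exact_lsmul_mkQ x) h1 h2)

theorem exact_lsmul_mkQ_span (x : R) :
    Function.Exact (LinearMap.lsmul R R x) (Ideal.span {x}).mkQ := by
  intro a
  rw [Submodule.mkQ_apply, Submodule.Quotient.mk_eq_zero, Ideal.mem_span_singleton']
  simp [mul_comm]

theorem extVanishes_quotSMulTop_self [IsNoetherianRing R] [Module.Finite R M]
    (hxR : IsSMulRegular R x) (hxM : IsSMulRegular M x) {n : ℕ}
    (h1 : ExtVanishes R (n + 1) M R) (h2 : ExtVanishes R (n + 2) M R) :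
    ExtVanishes (R ⧸ Ideal.span {x}) (n + 1) (QuotSMulTop x M) (R ⧸ Ideal.span {x}) :=
  extVanishes_quotSMulTop_left hxR n M hxM (extVanishes_right_lst
    (lsmul_injective hxR) (Submodule.mkQ_surjective _) (exact_lsmul_mkQ_span x) h1 h2)

theorem exists_surjective_of_quotSMulTop [IsLocalRing R] (hxR : IsSMulRegular R x)
    (hx : x ∈ maximalIdeal R) (hM : ExtVanishes R 1 M R)
    {g : QuotSMulTop x M →ₗ[R ⧸ Ideal.span {x}] R ⧸ Ideal.span {x}}
    (hg : Function.Surjective g) : ∃ h : M →ₗ[R] R, Function.Surjective h := by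
  obtain ⟨h, hh⟩ := exists_lift_of_extVanishes (lsmul_injective hxR)
    (Submodule.mkQ_surjective _) (exact_lsmul_mkQ_span x) hM
    (g.restrictScalars R ∘ₗ Submodule.mkQ _)
  obtain ⟨m, hm⟩ := hg 1
  obtain ⟨m, rfl⟩ := Submodule.Quotient.mk_surjective _ m
  have h1 : Ideal.Quotient.mk (Ideal.span {x}) (h m) = 1 :=
    (LinearMap.congr_fun hh m).trans hm
  have h2 : IsUnit (h m) := by
    by_contra hu
    have h3 : h m - 1 ∈ Ideal.span {x} := by
      rw [← Ideal.Quotient.eq_zero_iff_mem, map_sub, h1, map_one, sub_self]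
    have h4 : (1 : R) ∈ maximalIdeal R := by
      have := sub_mem ((mem_maximalIdeal _).2 hu)
        ((Ideal.span_singleton_le_iff_mem _).2 hx h3)
      rwa [sub_sub_cancel] at this
    exact (Ideal.ne_top_iff_one _).1 (maximalIdeal.isMaximal R).ne_top h4
  obtain ⟨w, hw⟩ := h2
  refine ⟨h, fun a => ⟨(a * ↑w⁻¹) • m, ?_⟩⟩
  simp [← hw]

end

theorem exists_surjective_of_injDimLE (d : ℕ) : ∀ (R : Type) [CommRing R] [IsNoetherianRing R]
    [IsLocalRing R], ringKrullDim R ≤ d → ∀ (M N : Type) [AddCommGroup M] [Module R M]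
    [AddCommGroup N] [Module R N] [Module.Finite R M] [Module.Finite R N] [Nontrivial M] (n : ℕ),
    InjDimLE R n N → ∀ (ι : N →ₗ[R] (M →ₗ[R] M)) (e : N), Function.Injective ι →
    ι e = LinearMap.id → (1 ≤ d → Function.Surjective ι) →
    (∀ i, 1 ≤ i → i ≤ d - 1 → ExtVanishes R i M M) →
    (∀ j, 1 ≤ j → j ≤ d → ExtVanishes R j M R) →
    ∃ g : M →ₗ[R] R, Function.Surjective g := by
  induction d with
  | zero =>
    intro R _ _ _ hR M N _ _ _ _ _ _ _ n hN ι e hι he _ _ _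
    rcases exists_isSMulRegular_or_exists_injective (R := R) (A := R) with ⟨x, hx, hxR⟩ | ⟨c, hc⟩
    · have h1 := Module.supportDim_quotSMulTop_succ_eq_supportDim hxR hx
      rw [Module.supportDim_self_eq_ringKrullDim] at h1
      have h2 := WithBot.eq_bot_of_add_one_le_zero (h1.trans_le hR)
      rw [Module.supportDim_eq_bot_iff_subsingleton] at h2
      exact absurd (subsingleton_of_subsingleton_quotSMulTop hx h2) (not_subsingleton R)
    · have := hN.injective_of_residueField_embedding hc
      exact exists_surjective_of_injective_endo ι hι he
  | succ d ih =>
    intro R _ _ _ hR M N _ _ _ _ _ _ _ n hN ι e hι he hιs hMM hMR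
    rcases exists_isSMulRegular_or_exists_injective (R := R) (A := R) with ⟨x, hx, hxR⟩ | ⟨c, hc⟩
    · have hN' := hN.of_ringKrullDim_le hR
      have hxM : IsSMulRegular M x := isSMulRegular_of_forall_dual
        (fun m hm => eq_zero_of_forall_dual_eq_zero hN' hMR ι he hm) hxR
      have hxN : IsSMulRegular N x := by
        refine IsSMulRegular.of_right_eq_zero_of_smul fun a ha => hι ?_
        ext m
        refine hxM ?_
        change x • ι a m = x • ι 0 m
        rw [← LinearMap.smul_apply, ← map_smul, ha, map_zero, LinearMap.zero_apply, smul_zero]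
      have hspan : Ideal.span {x} ≤ maximalIdeal R := by
        rwa [Ideal.span_singleton_le_iff_mem]
      have : Nontrivial (R ⧸ Ideal.span {x}) := Ideal.Quotient.nontrivial_iff.2
        (ne_top_of_le_ne_top (maximalIdeal.isMaximal R).ne_top hspan)
      have : IsLocalRing (R ⧸ Ideal.span {x}) := IsLocalRing.of_surjective' (Ideal.Quotient.mk _)
        Ideal.Quotient.mk_surjective
      have hS : ringKrullDim (R ⧸ Ideal.span {x}) ≤ d := by
        refine WithBot.le_of_add_one_le_succ ?_
        rw [ringKrullDim_quotient_span_singleton_succ_eq_ringKrullDim hxR hx]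
        exact hR
      have : Nontrivial (QuotSMulTop x M) := nontrivial_quotSMulTop hx
      have : Module.Finite (R ⧸ Ideal.span {x}) (QuotSMulTop x M) :=
        Module.Finite.of_restrictScalars_finite R _ _
      have : Module.Finite (R ⧸ Ideal.span {x}) (QuotSMulTop x N) :=
        Module.Finite.of_restrictScalars_finite R _ _
      obtain ⟨κ, hκ⟩ := exists_endo_quotSMulTop x ι
      have hκe : κ (Submodule.Quotient.mk e) = LinearMap.id := by rw [hκ, he, quotMap_id]
      have hκs : 1 ≤ d → Function.Surjective κ := fun hd =>
        surjective_endo_quotSMulTop hκ hxM (hιs (by omega)) (hMM 1 le_rfl (by omega))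
      have hMM' : ∀ i, 1 ≤ i → i ≤ d - 1 →
          ExtVanishes (R ⧸ Ideal.span {x}) i (QuotSMulTop x M) (QuotSMulTop x M) := by
        intro i hi hid
        obtain ⟨i, rfl⟩ : ∃ i', i = i' + 1 := ⟨i - 1, by omega⟩
        exact extVanishes_quotSMulTop hxR hxM hxM (hMM _ hi (by omega))
          (hMM _ (by omega) (by omega))
      have hMR' : ∀ j, 1 ≤ j → j ≤ d →
          ExtVanishes (R ⧸ Ideal.span {x}) j (QuotSMulTop x M) (R ⧸ Ideal.span {x}) := by
        intro j hj hjd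
        obtain ⟨j, rfl⟩ : ∃ j', j = j' + 1 := ⟨j - 1, by omega⟩
        exact extVanishes_quotSMulTop_self hxR hxM (hMR _ hj (by omega))
          (hMR _ (by omega) (by omega))
      obtain ⟨g, hg⟩ := ih (R ⧸ Ideal.span {x}) hS (QuotSMulTop x M) (QuotSMulTop x N) _
        (hN'.quotSMulTop hxR hxN) κ _
        (injective_endo_quotSMulTop hκ hxM ⟨hι, hιs (by omega)⟩) hκe hκs hMM' hMR'
      exact exists_surjective_of_quotSMulTop hxR hx (hMR 1 le_rfl (by omega)) hg
    · have := hN.injective_of_residueField_embedding hc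
      exact exists_surjective_of_injective_endo ι hι he

end Core

section Freeness

variable {R : Type} [CommRing R] {M : Type} [AddCommGroup M] [Module R M]

theorem extVanishes_of_subsingleton_extMod {A B : Type} [AddCommGroup A] [Module R A]
    [AddCommGroup B] [Module R B] {i : ℕ} (hi : 1 ≤ i) (h : Subsingleton (extMod R i A B)) :
    ExtVanishes R i A B := by
  obtain ⟨i, rfl⟩ : ∃ i', i = i' + 1 := ⟨i - 1, by omega⟩
  exact (subsingleton_extMod_iff i A B).1 h

theorem hasFiniteInjDim_of_retract {A B : Type} [AddCommGroup A] [Module R A]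
    [AddCommGroup B] [Module R B] (s : A →ₗ[R] B) (p : B →ₗ[R] A) (h : p ∘ₗ s = LinearMap.id)
    (hB : HasFiniteInjDim R B) : HasFiniteInjDim R A := by
  obtain ⟨n, hn⟩ := hB
  refine ⟨n, fun L _ _ i hi => ?_⟩
  obtain ⟨i, rfl⟩ : ∃ i', i = i' + 1 := ⟨i - 1, by omega⟩
  exact (subsingleton_extMod_iff i L A).2
    (extVanishes_of_retract_right s p h (extVanishes_of_subsingleton_extMod (by omega) (hn L _ hi)))

/-- A retract `K` of `M` has `End K` a retract of `End M`. -/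
theorem hasFiniteInjDim_endo_of_retract {K : Type} [AddCommGroup K] [Module R K]
    (s : K →ₗ[R] M) (p : M →ₗ[R] K) (h : p ∘ₗ s = LinearMap.id)
    (hM : HasFiniteInjDim R (M →ₗ[R] M)) : HasFiniteInjDim R (K →ₗ[R] K) := by
  refine hasFiniteInjDim_of_retract (LinearMap.llcomp R M K M s ∘ₗ LinearMap.lcomp R K p)
    (LinearMap.llcomp R K M K p ∘ₗ LinearMap.lcomp R M s) ?_ hM
  refine LinearMap.ext fun φ => LinearMap.ext fun k => ?_
  have h1 : ∀ k, p (s k) = k := LinearMap.congr_fun h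
  change p (s (φ (p (s k)))) = φ k
  rw [h1, h1]

theorem exists_rightInverse_pi {r : ℕ} {p : M →ₗ[R] (Fin r → R)} (hp : Function.Surjective p) :
    ∃ s : (Fin r → R) →ₗ[R] M, p ∘ₗ s = LinearMap.id :=
  Module.projective_lifting_property p LinearMap.id hp

variable [IsNoetherianRing R] [IsLocalRing R] [Module.Finite R M] {d : ℕ}

theorem exists_surjective_of_hasFiniteInjDim_endo [Nontrivial M] (hd : ringKrullDim R ≤ d)
    (hinj : HasFiniteInjDim R (M →ₗ[R] M))
    (hMM : ∀ i, 1 ≤ i → i ≤ d - 1 → ExtVanishes R i M M)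
    (hMR : ∀ j, 1 ≤ j → j ≤ d → ExtVanishes R j M R) :
    ∃ g : M →ₗ[R] R, Function.Surjective g := by
  obtain ⟨n, hn⟩ := hinj
  exact exists_surjective_of_injDimLE d R hd M (M →ₗ[R] M) n
    (fun L _ _ _ i hi => extVanishes_of_subsingleton_extMod (by omega) (hn L i hi))
    LinearMap.id LinearMap.id Function.injective_id rfl (fun _ => Function.surjective_id) hMM hMR

theorem exists_surjective_pi_of_not_free (hd : ringKrullDim R ≤ d)
    (hinj : HasFiniteInjDim R (M →ₗ[R] M))
    (hMM : ∀ i, 1 ≤ i → i ≤ d - 1 → ExtVanishes R i M M)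
    (hMR : ∀ j, 1 ≤ j → j ≤ d → ExtVanishes R j M R) (hM : ¬ Module.Free R M) (r : ℕ) :
    ∃ p : M →ₗ[R] (Fin r → R), Function.Surjective p := by
  induction r with
  | zero => exact ⟨0, fun _ => ⟨0, Subsingleton.elim _ _⟩⟩
  | succ r ih =>
    obtain ⟨p, hp⟩ := ih
    obtain ⟨s, hs⟩ := exists_rightInverse_pi hp
    have hs' : ∀ v, p (s v) = v := LinearMap.congr_fun hs
    let q : M →ₗ[R] LinearMap.ker p := (LinearMap.id - s ∘ₗ p).codRestrict _ fun m => by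
      simp [hs']
    have hq : q ∘ₗ (LinearMap.ker p).subtype = LinearMap.id := by
      ext ⟨m, hm⟩
      simp [q, LinearMap.mem_ker.1 hm]
    have : Nontrivial (LinearMap.ker p) := by
      by_contra h
      rw [Submodule.nontrivial_iff_ne_bot, not_not, LinearMap.ker_eq_bot] at h
      exact hM (Module.Free.of_equiv (LinearEquiv.ofBijective p ⟨h, hp⟩).symm)
    obtain ⟨g, hg⟩ := exists_surjective_of_hasFiniteInjDim_endo (M := LinearMap.ker p) hd
      (hasFiniteInjDim_endo_of_retract _ q hq hinj)
      (fun i hi hid => extVanishes_of_retract_left _ q hq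
        (extVanishes_of_retract_right _ q hq (hMM i hi hid)))
      (fun j hj hjd => extVanishes_of_retract_left _ q hq (hMR j hj hjd))
    refine ⟨(Fin.consLinearEquiv R fun _ : Fin (r + 1) => R).toLinearMap ∘ₗ
      LinearMap.prod (M₂ := R) (g ∘ₗ q) p, ?_⟩
    refine (LinearEquiv.surjective (Fin.consLinearEquiv R fun _ : Fin (r + 1) => R)).comp ?_
    rintro ⟨a, v⟩
    obtain ⟨k, rfl⟩ := hg a
    refine ⟨k + s v, Prod.ext ?_ ?_⟩
    · have h1 : q k = k := LinearMap.congr_fun hq k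
      have h2 : q (s v) = 0 := Subtype.ext (by simp [q, hs'])
      simp [h1, h2]
    · simp [hs']

theorem free_of_hasFiniteInjDim_endo (hd : ringKrullDim R ≤ d)
    (hinj : HasFiniteInjDim R (M →ₗ[R] M))
    (hMM : ∀ i, 1 ≤ i → i ≤ d - 1 → ExtVanishes R i M M)
    (hMR : ∀ j, 1 ≤ j → j ≤ d → ExtVanishes R j M R) : Module.Free R M := by
  by_contra hM
  obtain ⟨m, π, hπ⟩ := Module.Finite.exists_fin' R M
  obtain ⟨p, hp⟩ := exists_surjective_pi_of_not_free hd hinj hMM hMR hM (m + 1)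
  have := le_of_fin_surjective R (p ∘ₗ π) (hp.comp hπ)
  omega

omit [IsNoetherianRing R] [IsLocalRing R] [Module.Finite R M] in
theorem hasFiniteInjDim_self_of_surjective {g : M →ₗ[R] R} (hg : Function.Surjective g)
    (hinj : HasFiniteInjDim R (M →ₗ[R] M)) : HasFiniteInjDim R R := by
  obtain ⟨m, hm⟩ := hg 1
  refine hasFiniteInjDim_of_retract (LinearMap.lsmul R M) (g ∘ₗ LinearMap.applyₗ m) ?_ hinj
  ext
  simp [hm]

end Freeness

theorem free_and_gorenstein_of_finite_injdim_endo
    (R : Type) [CommRing R] [IsNoetherianRing R] [IsLocalRing R]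
    (d : ℕ) (hd : ringKrullDim R = d)
    (M : Type) [AddCommGroup M] [Module R M] [Module.Finite R M] [Nontrivial M]
    (hinj : HasFiniteInjDim R (M →ₗ[R] M))
    (hextM : ∀ i : ℕ, 1 ≤ i → i ≤ d - 1 → Subsingleton (extMod R i M M))
    (hextR : ∀ j : ℕ, 1 ≤ j → j ≤ d → Subsingleton (extMod R j M R)) :
    Module.Free R M ∧ HasFiniteInjDim R R := by
  have hMM i hi hid := extVanishes_of_subsingleton_extMod hi (hextM i hi hid)
  have hMR j hj hjd := extVanishes_of_subsingleton_extMod hj (hextR j hj hjd)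
  obtain ⟨g, hg⟩ := exists_surjective_of_hasFiniteInjDim_endo hd.le hinj hMM hMR
  exact ⟨free_of_hasFiniteInjDim_endo hd.le hinj hMM hMR,
    hasFiniteInjDim_self_of_surjective hg hinj⟩
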